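/- Let G be a finitely generated group of super-linear growth, with word length |·|_G, balls B_G(r), and right-invariant word metric d_G. Then there is a finite constant c with the following property: for any real r ≥ 1, every nonempty connected (1,r)-Følner set F ⊆ G has a (2r)-skeleton (V,E) of the metric space (F, d_G) satisfying wt_{d_G}(V,E) ≤ c|F|/r. -/

import Mathlib

open Filter
open scoped Pointwise

/-- The word length of `g` with respect to the generating set `S`. -/
noncomputable def wordLength {G : Type*} [Group G] (S : Set G) (g : G) : ℕ :=
  sInf {n | ∃ l : List G, l.length = n ∧ (∀ s ∈ l, s ∈ S) ∧ l.prod = g}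

/-- The right-invariant word metric `d_G(g,h) = |g h⁻¹|_G`. -/
noncomputable def wordDist {G : Type*} [Group G] (S : Set G) (g h : G) : ℕ :=
  wordLength S (g * h⁻¹)

/-- The ball `B_G(r) = {g : |g|_G ≤ r}`. -/
def wordBall {G : Type*} [Group G] (S : Set G) (r : ℝ) : Set G :=
  {g : G | (wordLength S g : ℝ) ≤ r}

/-- `F` is an (ε,r)-Følner set: finite, nonempty, with `|(B_G(r)·F) \ F| ≤ ε|F|`. -/
def IsFolner {G : Type*} [Group G] (S : Set G) (ε r : ℝ) (F : Set G) : Prop :=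
  F.Finite ∧ F.Nonempty ∧
    (((wordBall S r * F) \ F).ncard : ℝ) ≤ ε * (F.ncard : ℝ)

/-- `E` is r-connected for the word metric. -/
def RConnected {G : Type*} [Group G] (S : Set G) (r : ℝ) (E : Set G) : Prop :=
  ∀ g ∈ E, ∀ h ∈ E, Relation.ReflTransGen
    (fun a b => a ∈ E ∧ b ∈ E ∧ (wordDist S a b : ℝ) ≤ r) g h

/-- One step along an (undirected) edge of the graph with edge set `E`. -/
def edgeStep {Z : Type*} (E : Finset (Z × Z)) (a b : Z) : Prop :=
  (a, b) ∈ E ∨ (b, a) ∈ E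

/-! ### The growth gap for factorial languages -/

section Language

variable {A : Type*}

/-- The words of a language `L` that extend on the right to arbitrarily long words of `L`. -/
def rightExtendable (L : Set (List A)) : Set (List A) :=
  {w | ∀ T : ℕ, ∃ y : List A, y.length = T ∧ w ++ y ∈ L}

lemma exists_forall_mem_rightExtendable {L : Set (List A)}
    (hpre : ∀ u v, u ++ v ∈ L → u ∈ L) {W : Set (List A)} (hW : W.Finite) :
    ∃ T : ℕ, ∀ w ∈ W, ∀ y : List A, T ≤ y.length → w ++ y ∈ L → w ∈ rightExtendable L := by
  classical
  have h : ∀ w : List A, ∃ T : ℕ, ∀ y : List A, T ≤ y.length → w ++ y ∈ L →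
      w ∈ rightExtendable L := by
    intro w
    by_cases hw : w ∈ rightExtendable L
    · exact ⟨0, fun _ _ _ => hw⟩
    · simp only [rightExtendable, Set.mem_ofPred_eq, not_forall, not_exists, not_and] at hw
      obtain ⟨T, hT⟩ := hw
      refine ⟨T, fun y hy hL => absurd ?_ (hT (y.take T) (by simpa using hy))⟩
      apply hpre _ (y.drop T)
      simpa [List.append_assoc] using hL
  choose f hf using h
  refine ⟨hW.toFinset.sup f, fun w hw y hy => hf w y (le_trans ?_ hy)⟩
  exact Finset.le_sup (f := f) (hW.mem_toFinset.2 hw)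

lemma append_mem_of_rightExtendable {L : Set (List A)} (hpre : ∀ u v, u ++ v ∈ L → u ∈ L)
    {u v : List A} (h : u ++ v ∈ rightExtendable L) : u ∈ rightExtendable L := by
  intro T
  obtain ⟨y, hy, hL⟩ := h T
  refine ⟨(v ++ y).take T, by simp; omega, hpre _ ((v ++ y).drop T) ?_⟩
  rw [List.append_assoc, List.take_append_drop, ← List.append_assoc]
  exact hL

lemma exists_concat_mem_rightExtendable [Finite A] {L : Set (List A)}
    (hpre : ∀ u v, u ++ v ∈ L → u ∈ L) {w : List A} (hw : w ∈ rightExtendable L) :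
    ∃ a, w ++ [a] ∈ rightExtendable L := by
  obtain ⟨T, hT⟩ := exists_forall_mem_rightExtendable hpre
    (Set.finite_range fun a : A => w ++ [a])
  obtain ⟨y, hy, hL⟩ := hw (T + 1)
  obtain ⟨a, y, rfl⟩ := List.exists_of_length_succ y hy
  refine ⟨a, hT _ ⟨a, rfl⟩ y ?_ (by simpa using hL)⟩
  simp at hy
  omega

lemma exists_unique_concat_of_ncard_le [Finite A] {L : Set (List A)}
    (hpre : ∀ u v, u ++ v ∈ L → u ∈ L) {k : ℕ}
    (hk : {w | w ∈ L ∧ w.length = k}.ncard ≤ k) :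
    ∃ j : ℕ, ∀ (u : List A) (a b : A), u.length = j → u ++ [a] ∈ rightExtendable L →
      u ++ [b] ∈ rightExtendable L → a = b := by
  set M : ℕ → Set (List A) := fun n => {w | w ∈ rightExtendable L ∧ w.length = n}
  have hfin : ∀ n, (M n).Finite := fun n =>
    (List.finite_length_eq A n).subset fun w hw => hw.2
  have hj : ∃ j, (M (j + 1)).ncard ≤ (M j).ncard := by
    by_contra! hlt
    have hne : (M 1).Nonempty :=
      (Set.ncard_pos (hfin 1)).1 (lt_of_le_of_lt (Nat.zero_le _) (hlt 0))
    obtain ⟨w, hw, -⟩ := hne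
    have h0 : 0 < (M 0).ncard := (Set.ncard_pos (hfin 0)).2
      ⟨[], append_mem_of_rightExtendable hpre (v := w) (by simpa using hw), rfl⟩
    have hge : ∀ n, n + 1 ≤ (M n).ncard := by
      intro n
      induction n with
      | zero => exact h0
      | succ n ih => exact lt_of_le_of_lt ih (hlt n)
    have hle : (M k).ncard ≤ {w | w ∈ L ∧ w.length = k}.ncard := by
      refine Set.ncard_le_ncard (fun w hw => ⟨?_, hw.2⟩)
        ((List.finite_length_eq A k).subset fun w hw => hw.2)
      obtain ⟨y, -, hy⟩ := hw.1 0
      exact hpre _ _ hy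
    have := hge k
    omega
  obtain ⟨j, hj⟩ := hj
  refine ⟨j, fun u a b hu ha hb => ?_⟩
  have hsurj : Set.SurjOn List.dropLast (M (j + 1)) (M j) := by
    intro w hw
    obtain ⟨c, hc⟩ := exists_concat_mem_rightExtendable hpre hw.1
    exact ⟨w ++ [c], ⟨hc, by simpa using hw.2⟩, by simp⟩
  have hmaps : Set.MapsTo List.dropLast (M (j + 1)) (M j) := by
    rintro w ⟨hw, hl⟩
    refine ⟨?_, by simp [hl]⟩
    have hne : w ≠ [] := by rintro rfl; simp at hl
    apply append_mem_of_rightExtendable hpre (v := [w.getLast hne])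
    rwa [List.dropLast_append_getLast]
  have hinj : Set.InjOn List.dropLast (M (j + 1)) := by
    have hcard := Finset.injOn_of_surjOn_of_card_le (s := (hfin (j + 1)).toFinset)
      (t := (hfin j).toFinset) List.dropLast (by simpa using hmaps) (by simpa using hsurj)
      (by rwa [← Set.ncard_eq_toFinset_card _ (hfin _), ← Set.ncard_eq_toFinset_card _ (hfin _)])
    simpa using hcard
  have := hinj (x₁ := u ++ [a]) (x₂ := u ++ [b]) ⟨ha, by simp [hu]⟩ ⟨hb, by simp [hu]⟩ (by simp)
  simpa using this

/-- A factorial language over a finite alphabet with at most `k` words of some length `k` has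
bounded complexity. -/
theorem exists_ncard_le_of_factorial [Finite A] {L : Set (List A)}
    (hpre : ∀ u v, u ++ v ∈ L → u ∈ L) (hsuf : ∀ u v, u ++ v ∈ L → v ∈ L) {k : ℕ}
    (hk : {w | w ∈ L ∧ w.length = k}.ncard ≤ k) :
    ∃ C : ℕ, ∀ n, {w | w ∈ L ∧ w.length = n}.ncard ≤ C := by
  obtain ⟨j, hj⟩ := exists_unique_concat_of_ncard_le hpre hk
  obtain ⟨T, hT⟩ := exists_forall_mem_rightExtendable hpre (List.finite_length_eq A (j + 1))
  have key : ∀ n (x x' y y' : List A), x.length = n → x'.length = n → x.take j = x'.take j →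
      T ≤ y.length → T ≤ y'.length → x ++ y ∈ L → x' ++ y' ∈ L → x = x' := by
    intro n
    induction n with
    | zero =>
      intro x x' y y' hx hx' _ _ _ _ _
      rw [List.length_eq_zero_iff.1 hx, List.length_eq_zero_iff.1 hx']
    | succ n ih =>
      intro x x' y y' hx hx' htake hy hy' hL hL'
      rcases Nat.lt_or_ge n j with hnj | hnj
      · rwa [List.take_of_length_le (by omega), List.take_of_length_le (by omega)] at htake
      obtain ⟨u, a, rfl⟩ := List.eq_nil_or_concat x |>.resolve_left (by rintro rfl; simp at hx)
      obtain ⟨u', b, rfl⟩ := List.eq_nil_or_concat x' |>.resolve_left (by rintro rfl; simp at hx')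
      simp only [List.concat_eq_append, List.length_append, List.length_singleton,
        Nat.add_right_cancel_iff] at hx hx'
      simp only [List.concat_eq_append] at htake hL hL' ⊢
      rw [List.take_append_of_le_length (by omega), List.take_append_of_le_length (by omega)]
        at htake
      have huu : u = u' := ih u u' ([a] ++ y) ([b] ++ y') hx hx' htake (by simp; omega)
        (by simp; omega) (by simpa using hL) (by simpa using hL')
      subst huu
      have hsplit : u.take (n - j) ++ u.drop (n - j) = u := List.take_append_drop _ _
      have hlen : (u.drop (n - j)).length = j := by simp; omega
      have hext : ∀ (c : A) (z : List A), T ≤ z.length → u ++ [c] ++ z ∈ L →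
          u.drop (n - j) ++ [c] ∈ rightExtendable L := by
        intro c z hz hmem
        refine hT _ (by simp; omega) z hz (hsuf (u.take (n - j)) _ ?_)
        rw [← List.append_assoc, ← List.append_assoc, hsplit]
        exact hmem
      rw [hj _ a b hlen (hext a y hy hL) (hext b y' hy' hL')]
  have hfin : ({w : List A | w.length ≤ j} ×ˢ {w : List A | w.length ≤ T}).Finite :=
    (List.finite_length_le A j).prod (List.finite_length_le A T)
  refine ⟨_, fun n => Set.ncard_le_ncard_of_injOn
    (fun z => ((z.take (n - T)).take j, z.drop (n - T))) ?_ ?_ hfin⟩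
  · rintro z ⟨-, hz⟩
    simp only [Set.mem_prod, Set.mem_ofPred_eq, List.length_take, List.length_drop]
    omega
  · rintro z ⟨hzL, hz⟩ z' ⟨hzL', hz'⟩ h
    simp only [Prod.mk.injEq] at h
    rw [← List.take_append_drop (n - T) z, ← List.take_append_drop (n - T) z', h.2]
    congr 1
    rcases Nat.lt_or_ge n T with hn | hn
    · simp [Nat.sub_eq_zero_of_le hn.le]
    · refine key (n - T) _ _ (z.drop (n - T)) (z'.drop (n - T)) ?_ ?_ h.1 ?_ ?_ ?_ ?_
      · simp; omega
      · simp; omega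
      · simp; omega
      · simp; omega
      · simpa using hzL
      · simpa using hzL'

lemma List.Shortlex.append_append {r : A → A → Prop} {s t : List A}
    (h : List.Shortlex r s t) (u : List A) : List.Shortlex r (s ++ u) (t ++ u) := by
  rcases List.shortlex_def.1 h with h | ⟨hl, h⟩
  · exact .of_length_lt (by simpa using h)
  · refine .of_lex (by simpa using hl) ?_
    clear * - hl h
    induction h with
    | nil => simp at hl
    | cons _ ih => exact .cons (ih (by simpa using hl))
    | rel h => exact .rel h

end Language

/-! ### Word length -/

section WordLength

variable {G : Type*} [Group G] {S : Set G}

lemma wordLength_prod_le {l : List G} (hl : ∀ s ∈ l, s ∈ S) :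
    wordLength S l.prod ≤ l.length :=
  Nat.sInf_le ⟨l, rfl, hl, rfl⟩

lemma wordLength_one : wordLength S (1 : G) = 0 :=
  Nat.le_zero.1 (wordLength_prod_le (l := []) (by simp))

lemma exists_list_length_eq_wordLength (hSsym : ∀ s ∈ S, s⁻¹ ∈ S)
    (hSgen : Subgroup.closure S = ⊤) (g : G) :
    ∃ l : List G, l.length = wordLength S g ∧ (∀ s ∈ l, s ∈ S) ∧ l.prod = g := by
  have hne : {n | ∃ l : List G, l.length = n ∧ (∀ s ∈ l, s ∈ S) ∧ l.prod = g}.Nonempty := by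
    have hg : g ∈ (Subgroup.closure S).toSubmonoid := by rw [hSgen]; trivial
    rw [Subgroup.closure_toSubmonoid] at hg
    obtain ⟨l, hl, hg⟩ := Submonoid.exists_list_of_mem_closure hg
    refine ⟨l.length, l, rfl, fun s hs => ?_, hg⟩
    rcases hl s hs with h | h
    · exact h
    · simpa using hSsym _ h
  exact Nat.sInf_mem hne

lemma wordLength_mul_le (hSsym : ∀ s ∈ S, s⁻¹ ∈ S) (hSgen : Subgroup.closure S = ⊤) (g h : G) :
    wordLength S (g * h) ≤ wordLength S g + wordLength S h := by
  obtain ⟨l, hl, hlS, rfl⟩ := exists_list_length_eq_wordLength hSsym hSgen g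
  obtain ⟨m, hm, hmS, rfl⟩ := exists_list_length_eq_wordLength hSsym hSgen h
  rw [← hl, ← hm, ← List.prod_append, ← List.length_append]
  refine wordLength_prod_le fun s hs => ?_
  rcases List.mem_append.1 hs with h | h
  exacts [hlS s h, hmS s h]

lemma wordLength_inv_le (hSsym : ∀ s ∈ S, s⁻¹ ∈ S) (hSgen : Subgroup.closure S = ⊤) (g : G) :
    wordLength S g⁻¹ ≤ wordLength S g := by
  obtain ⟨l, hl, hlS, rfl⟩ := exists_list_length_eq_wordLength hSsym hSgen g
  rw [← hl, List.prod_inv_reverse]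
  refine (wordLength_prod_le fun s hs => ?_).trans (by simp)
  obtain ⟨t, ht, rfl⟩ := List.mem_map.1 (List.mem_reverse.1 hs)
  exact hSsym _ (hlS t ht)

lemma wordDist_comm (hSsym : ∀ s ∈ S, s⁻¹ ∈ S) (hSgen : Subgroup.closure S = ⊤) (g h : G) :
    wordDist S g h = wordDist S h g := by
  have key : ∀ a b : G, wordDist S a b ≤ wordDist S b a := fun a b => by
    simpa [wordDist] using wordLength_inv_le hSsym hSgen (b * a⁻¹)
  exact le_antisymm (key g h) (key h g)

lemma wordDist_triangle (hSsym : ∀ s ∈ S, s⁻¹ ∈ S) (hSgen : Subgroup.closure S = ⊤) (f g h : G) :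
    wordDist S f h ≤ wordDist S f g + wordDist S g h := by
  simpa [wordDist] using wordLength_mul_le hSsym hSgen (f * g⁻¹) (g * h⁻¹)

/-- The element of `G` represented by a word in `S`. -/
def evalWord (w : List S) : G := (w.map Subtype.val).prod

lemma evalWord_append (u v : List S) : evalWord (u ++ v) = evalWord u * evalWord v := by
  simp [evalWord]

lemma wordLength_evalWord_le (w : List S) : wordLength S (evalWord w) ≤ w.length := by
  refine (wordLength_prod_le fun s hs => ?_).trans (by simp)
  obtain ⟨t, -, rfl⟩ := List.mem_map.1 hs
  exact t.2

lemma exists_evalWord_eq (hSsym : ∀ s ∈ S, s⁻¹ ∈ S) (hSgen : Subgroup.closure S = ⊤) (g : G) :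
    ∃ w : List S, w.length = wordLength S g ∧ evalWord w = g := by
  obtain ⟨l, hl, hlS, rfl⟩ := exists_list_length_eq_wordLength hSsym hSgen g
  refine ⟨l.attach.map fun s => ⟨s.1, hlS s.1 s.2⟩, by simpa using hl, ?_⟩
  simp [evalWord, List.map_map, Function.comp_def]

/-- The words that are shortlex-minimal among those representing the same element. -/
def shortlexNormalForms (S : Set G) : Set (List S) :=
  {w | ∀ w' : List S, evalWord w' = evalWord w → ¬ List.Shortlex WellOrderingRel w' w}

lemma mem_shortlexNormalForms_of_append_left (u v : List S) (h : u ++ v ∈ shortlexNormalForms S) :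
    u ∈ shortlexNormalForms S := fun u' hu' hlt =>
  h (u' ++ v) (by rw [evalWord_append, evalWord_append, hu']) (hlt.append_append v)

lemma mem_shortlexNormalForms_of_append_right (u v : List S) (h : u ++ v ∈ shortlexNormalForms S) :
    v ∈ shortlexNormalForms S := fun v' hv' hlt =>
  h (u ++ v') (by rw [evalWord_append, evalWord_append, hv']) (hlt.append_left u)

lemma length_eq_of_mem_shortlexNormalForms (hSsym : ∀ s ∈ S, s⁻¹ ∈ S)
    (hSgen : Subgroup.closure S = ⊤) {w : List S} (hw : w ∈ shortlexNormalForms S) :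
    w.length = wordLength S (evalWord w) := by
  refine le_antisymm ?_ (wordLength_evalWord_le w)
  obtain ⟨w', hl, hw'⟩ := exists_evalWord_eq hSsym hSgen (evalWord w)
  by_contra! hlt
  exact hw w' hw' (.of_length_lt (hl ▸ hlt))

lemma bijOn_evalWord (hSsym : ∀ s ∈ S, s⁻¹ ∈ S) (hSgen : Subgroup.closure S = ⊤) (n : ℕ) :
    Set.BijOn evalWord {w | w ∈ shortlexNormalForms S ∧ w.length = n}
      {g : G | wordLength S g = n} := by
  refine ⟨fun w hw => ?_, fun w hw w' hw' h => ?_, fun g hg => ?_⟩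
  · exact (length_eq_of_mem_shortlexNormalForms hSsym hSgen hw.1).symm.trans hw.2
  · exact Std.Trichotomous.trichotomous (r := List.Shortlex WellOrderingRel) w w'
      (hw'.1 w h) (hw.1 w' h.symm)
  · have hwf : WellFounded (List.Shortlex (WellOrderingRel (α := S))) :=
      List.Shortlex.wf WellOrderingRel.isWellOrder.wf
    obtain ⟨w₀, -, hw₀⟩ := exists_evalWord_eq hSsym hSgen g
    obtain ⟨w, hw, hmin⟩ := hwf.has_min {w : List S | evalWord w = g} ⟨w₀, hw₀⟩
    have hmem : w ∈ shortlexNormalForms S := fun w' h => hmin w' (h.trans hw)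
    refine ⟨w, ⟨hmem, ?_⟩, hw⟩
    rw [length_eq_of_mem_shortlexNormalForms hSsym hSgen hmem, hw]
    exact hg

lemma ncard_sphere_eq (hSsym : ∀ s ∈ S, s⁻¹ ∈ S) (hSgen : Subgroup.closure S = ⊤) (n : ℕ) :
    {g : G | wordLength S g = n}.ncard =
      {w | w ∈ shortlexNormalForms S ∧ w.length = n}.ncard := by
  have h := bijOn_evalWord hSsym hSgen n
  rw [← h.image_eq, h.injOn.ncard_image]

lemma finite_sphere (hSfin : S.Finite) (hSsym : ∀ s ∈ S, s⁻¹ ∈ S)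
    (hSgen : Subgroup.closure S = ⊤) (n : ℕ) : {g : G | wordLength S g = n}.Finite := by
  have := hSfin.to_subtype
  rw [← (bijOn_evalWord hSsym hSgen n).image_eq]
  exact ((List.finite_length_eq S n).subset fun w hw => hw.2).image _

lemma wordBall_natCast_succ (n : ℕ) :
    wordBall S ((n + 1 : ℕ) : ℝ) = wordBall S n ∪ {g : G | wordLength S g = n + 1} := by
  ext g
  simp only [wordBall, Set.mem_union, Set.mem_ofPred_eq, Nat.cast_le]
  omega

lemma wordBall_natCast_zero : wordBall S ((0 : ℕ) : ℝ) = {g : G | wordLength S g = 0} := by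
  ext g
  simp [wordBall]

lemma finite_wordBall (hSfin : S.Finite) (hSsym : ∀ s ∈ S, s⁻¹ ∈ S)
    (hSgen : Subgroup.closure S = ⊤) (n : ℕ) : (wordBall S (n : ℝ)).Finite := by
  induction n with
  | zero => rw [wordBall_natCast_zero]; exact finite_sphere hSfin hSsym hSgen 0
  | succ n ih => rw [wordBall_natCast_succ]; exact ih.union (finite_sphere hSfin hSsym hSgen _)

lemma ncard_wordBall_succ (hSfin : S.Finite) (hSsym : ∀ s ∈ S, s⁻¹ ∈ S)
    (hSgen : Subgroup.closure S = ⊤) (n : ℕ) :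
    (wordBall S ((n + 1 : ℕ) : ℝ)).ncard =
      (wordBall S n).ncard + {g : G | wordLength S g = n + 1}.ncard := by
  rw [wordBall_natCast_succ]
  refine Set.ncard_union_eq ?_ (finite_wordBall hSfin hSsym hSgen n)
    (finite_sphere hSfin hSsym hSgen _)
  rw [Set.disjoint_left]
  intro g hg hg'
  simp only [wordBall, Set.mem_ofPred_eq, Nat.cast_le] at hg hg'
  omega

lemma wordBall_eq_natFloor {r : ℝ} (hr : 0 ≤ r) : wordBall S r = wordBall S (⌊r⌋₊ : ℝ) := by
  ext g
  simp [wordBall, Nat.le_floor_iff hr]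

lemma lt_ncard_sphere (hSfin : S.Finite) (hSsym : ∀ s ∈ S, s⁻¹ ∈ S)
    (hSgen : Subgroup.closure S = ⊤)
    (hgrowth : Tendsto (fun n : ℕ => (((wordBall S n).ncard : ℝ) / (n : ℝ))) atTop atTop)
    (k : ℕ) : k < {g : G | wordLength S g = k}.ncard := by
  by_contra! hk
  have := hSfin.to_subtype
  rw [ncard_sphere_eq hSsym hSgen] at hk
  obtain ⟨C, hC⟩ := exists_ncard_le_of_factorial mem_shortlexNormalForms_of_append_left
    mem_shortlexNormalForms_of_append_right hk
  simp only [← ncard_sphere_eq hSsym hSgen] at hC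
  have hball : ∀ n : ℕ, (wordBall S (n : ℝ)).ncard ≤ C * (n + 1) := by
    intro n
    induction n with
    | zero => rw [wordBall_natCast_zero]; simpa using hC 0
    | succ n ih =>
      rw [ncard_wordBall_succ hSfin hSsym hSgen]
      have := hC (n + 1)
      linarith
  obtain ⟨n, hn, hn1⟩ := ((hgrowth.eventually_gt_atTop (2 * C : ℝ)).and
    (eventually_ge_atTop 1)).exists
  have hn0 : (1 : ℝ) ≤ n := by exact_mod_cast hn1
  rw [lt_div_iff₀ (by linarith)] at hn
  have h1 : ((wordBall S (n : ℝ)).ncard : ℝ) ≤ C * (n + 1) := by exact_mod_cast hball n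
  have h2 : (0 : ℝ) ≤ C := Nat.cast_nonneg C
  nlinarith

/-- A finitely generated group of super-linear growth has at least quadratic growth. -/
theorem sq_le_two_mul_ncard_wordBall (hSfin : S.Finite) (hSsym : ∀ s ∈ S, s⁻¹ ∈ S)
    (hSgen : Subgroup.closure S = ⊤)
    (hgrowth : Tendsto (fun n : ℕ => (((wordBall S n).ncard : ℝ) / (n : ℝ))) atTop atTop)
    {r : ℝ} (hr : 0 ≤ r) : r ^ 2 ≤ 2 * (wordBall S r).ncard := by
  have hnat : ∀ n : ℕ, (n + 1) ^ 2 ≤ 2 * (wordBall S (n : ℝ)).ncard := by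
    intro n
    induction n with
    | zero =>
      have := lt_ncard_sphere hSfin hSsym hSgen hgrowth 0
      rw [wordBall_natCast_zero]
      omega
    | succ n ih =>
      have := lt_ncard_sphere hSfin hSsym hSgen hgrowth (n + 1)
      rw [ncard_wordBall_succ hSfin hSsym hSgen]
      nlinarith
  rw [wordBall_eq_natFloor hr]
  have h : ((⌊r⌋₊ : ℝ) + 1) ^ 2 ≤ 2 * (wordBall S (⌊r⌋₊ : ℝ)).ncard := by
    exact_mod_cast hnat ⌊r⌋₊
  refine le_trans ?_ h
  have := Nat.lt_floor_add_one r
  gcongr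

/-! ### Separated skeletons -/

lemma card_mul_ncard_wordBall_le (hSfin : S.Finite) (hSsym : ∀ s ∈ S, s⁻¹ ∈ S)
    (hSgen : Subgroup.closure S = ⊤) {r : ℝ} (hr : 0 ≤ r) {F : Set G} (hF : IsFolner S 1 r F)
    {V : Finset G} (hVF : ↑V ⊆ F)
    (hsep : ∀ u ∈ V, ∀ v ∈ V, (wordDist S u v : ℝ) ≤ 2 * r → u = v) :
    (V.card : ℝ) * (wordBall S r).ncard ≤ 2 * F.ncard := by
  obtain ⟨hfin, -, hle⟩ := hF
  have hB : (wordBall S r).Finite := by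
    rw [wordBall_eq_natFloor hr]
    exact finite_wordBall hSfin hSsym hSgen _
  have hBF : (wordBall S r * F).Finite := hB.mul hfin
  have h1 : (wordBall S r * F).ncard ≤ ((wordBall S r * F) \ F).ncard + F.ncard := by
    refine (Set.ncard_le_ncard (t := ((wordBall S r * F) \ F) ∪ F) ?_ ?_).trans
      (Set.ncard_union_le _ _)
    · intro x hx
      by_cases h : x ∈ F
      exacts [Or.inr h, Or.inl ⟨hx, h⟩]
    · exact hBF.sdiff.union hfin
  have h2 : ((V : Set G) ×ˢ wordBall S r).ncard ≤ (wordBall S r * F).ncard := by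
    refine Set.ncard_le_ncard_of_injOn (fun p => p.2 * p.1) ?_ ?_ hBF
    · rintro ⟨v, b⟩ ⟨hv, hb⟩
      exact Set.mul_mem_mul hb (hVF hv)
    · rintro ⟨v, b⟩ ⟨hv, hb⟩ ⟨v', b'⟩ ⟨hv', hb'⟩ (h : b * v = b' * v')
      have hvv : v = v' := by
        refine hsep v hv v' hv' ?_
        have hq : v * v'⁻¹ = b⁻¹ * b' := by
          rw [eq_inv_mul_iff_mul_eq, ← mul_assoc, h]
          group
        have hd : wordDist S v v' ≤ wordLength S b + wordLength S b' := by
          rw [wordDist, hq]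
          exact (wordLength_mul_le hSsym hSgen _ _).trans
            (Nat.add_le_add_right (wordLength_inv_le hSsym hSgen b) _)
        have hd' : (wordDist S v v' : ℝ) ≤ wordLength S b + wordLength S b' := by
          exact_mod_cast hd
        have h₁ : (wordLength S b : ℝ) ≤ r := hb
        have h₂ : (wordLength S b' : ℝ) ≤ r := hb'
        linarith
      subst hvv
      simpa using h
  rw [Set.ncard_prod, Set.ncard_coe_finset] at h2
  have h3 : (V.card : ℝ) * (wordBall S r).ncard ≤
      ((wordBall S r * F) \ F).ncard + F.ncard := by exact_mod_cast h2.trans h1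
  linarith

/-- `(V, E)` is a connected graph on a nonempty `2r`-separated subset of `F`, with at most `|V|`
edges, each of length at most `2r + 1`. -/
structure IsSeparatedGraph (S : Set G) (r : ℝ) (F : Set G) (V : Finset G)
    (E : Finset (G × G)) : Prop where
  subset : ↑V ⊆ F
  nonempty : V.Nonempty
  separated : ∀ u ∈ V, ∀ v ∈ V, (wordDist S u v : ℝ) ≤ 2 * r → u = v
  mem : ∀ e ∈ E, e.1 ∈ V ∧ e.2 ∈ V
  connected : ∀ u ∈ V, ∀ v ∈ V, Relation.ReflTransGen (edgeStep E) u v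
  dist_le : ∀ e ∈ E, (wordDist S e.1 e.2 : ℝ) ≤ 2 * r + 1
  card_le : E.card ≤ V.card

/-- A separated graph that is not `2r`-dense in the connected set `F` can be enlarged. -/
lemma IsSeparatedGraph.exists_card_lt (hSsym : ∀ s ∈ S, s⁻¹ ∈ S)
    (hSgen : Subgroup.closure S = ⊤) {r : ℝ} (hr : 0 ≤ r) {F : Set G}
    (hF : RConnected S 1 F) {V : Finset G} {E : Finset (G × G)}
    (h : IsSeparatedGraph S r F V E) {g : G} (hg : g ∈ F)
    (hfar : ∀ v ∈ V, 2 * r < (wordDist S g v : ℝ)) :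
    ∃ V' E', IsSeparatedGraph S r F V' E' ∧ V.card < V'.card := by
  classical
  obtain ⟨v₀, hv₀⟩ := h.nonempty
  have hstep : ∃ b ∈ F, (∀ v ∈ V, 2 * r < (wordDist S b v : ℝ)) ∧
      ∃ v ∈ V, (wordDist S b v : ℝ) ≤ 2 * r + 1 := by
    by_contra! hno
    have hnear : ∀ b, Relation.ReflTransGen
        (fun a b => a ∈ F ∧ b ∈ F ∧ (wordDist S a b : ℝ) ≤ 1) v₀ b →
        ∃ v ∈ V, (wordDist S b v : ℝ) ≤ 2 * r := by
      intro b hb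
      induction hb with
      | refl => exact ⟨v₀, hv₀, by simp [wordDist, wordLength_one, hr]⟩
      | @tail a b _ hab ih =>
        obtain ⟨v, hv, hav⟩ := ih
        by_contra! hb
        have h₁ := hno b hab.2.1 hb v hv
        have h₂ : (wordDist S b v : ℝ) ≤ wordDist S a b + wordDist S a v := by
          rw [wordDist_comm hSsym hSgen a b]
          exact_mod_cast wordDist_triangle hSsym hSgen b a v
        linarith [hab.2.2]
    obtain ⟨v, hv, hgv⟩ := hnear g (hF v₀ (h.subset hv₀) g hg)
    linarith [hfar v hv]
  obtain ⟨b, hbF, hbfar, v, hv, hbv⟩ := hstep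
  have hbV : b ∉ V := fun hb => by
    have := hbfar b hb
    simp [wordDist, wordLength_one] at this
    linarith
  have hmono : ∀ u w, Relation.ReflTransGen (edgeStep E) u w →
      Relation.ReflTransGen (edgeStep (insert (b, v) E)) u w := fun u w huw =>
    Relation.ReflTransGen.mono (fun _ _ hab =>
      Or.imp Finset.mem_insert_of_mem Finset.mem_insert_of_mem hab) _ _ huw
  have hb_to : ∀ w ∈ V, Relation.ReflTransGen (edgeStep (insert (b, v) E)) b w := fun w hw =>
    .head (Or.inl (Finset.mem_insert_self _ _)) (hmono _ _ (h.connected v hv w hw))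
  have hto_b : ∀ w ∈ V, Relation.ReflTransGen (edgeStep (insert (b, v) E)) w b := fun w hw =>
    .tail (hmono _ _ (h.connected w hw v hv)) (Or.inr (Finset.mem_insert_self _ _))
  refine ⟨insert b V, insert (b, v) E, ⟨?_, Finset.insert_nonempty _ _, ?_, ?_, ?_, ?_, ?_⟩, ?_⟩
  · simp [Set.insert_subset_iff, hbF, h.subset]
  · intro u hu w hw huw
    rcases Finset.mem_insert.1 hu with rfl | hu' <;>
      rcases Finset.mem_insert.1 hw with rfl | hw'
    · rfl
    · linarith [hbfar w hw']
    · rw [wordDist_comm hSsym hSgen] at huw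
      linarith [hbfar u hu']
    · exact h.separated u hu' w hw' huw
  · intro e he
    rcases Finset.mem_insert.1 he with rfl | he
    · simp [hv]
    · exact (h.mem e he).imp Finset.mem_insert_of_mem Finset.mem_insert_of_mem
  · intro u hu w hw
    rcases Finset.mem_insert.1 hu with rfl | hu' <;>
      rcases Finset.mem_insert.1 hw with rfl | hw'
    · exact .refl
    · exact hb_to w hw'
    · exact hto_b u hu'
    · exact hmono _ _ (h.connected u hu' w hw')
  · intro e he
    rcases Finset.mem_insert.1 he with rfl | he
    exacts [hbv, h.dist_le e he]
  · rw [Finset.card_insert_of_notMem hbV]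
    exact (Finset.card_insert_le _ _).trans (Nat.add_le_add_right h.card_le 1)
  · rw [Finset.card_insert_of_notMem hbV]
    exact Nat.lt_succ_self _

/-- A finite nonempty connected set carries a `2r`-dense separated graph. -/
lemma exists_isSeparatedGraph_dense (hSsym : ∀ s ∈ S, s⁻¹ ∈ S)
    (hSgen : Subgroup.closure S = ⊤) {r : ℝ} (hr : 0 ≤ r) {F : Set G} (hfin : F.Finite)
    (hne : F.Nonempty) (hF : RConnected S 1 F) :
    ∃ V E, IsSeparatedGraph S r F V E ∧
      ∀ g ∈ F, ∃ v ∈ V, (wordDist S g v : ℝ) ≤ 2 * r := by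
  obtain ⟨g₀, hg₀⟩ := hne
  set P : Set ℕ := {n | ∃ V E, IsSeparatedGraph S r F V E ∧ V.card = n}
  have hPne : P.Nonempty :=
    ⟨1, {g₀}, ∅, ⟨by simpa using hg₀, by simp, by simp, by simp,
      by simp [Relation.ReflTransGen.refl], by simp, by simp⟩, by simp⟩
  have hPbdd : BddAbove P := by
    refine ⟨F.ncard, ?_⟩
    rintro n ⟨V, E, hVE, rfl⟩
    rw [← Set.ncard_coe_finset]
    exact Set.ncard_le_ncard hVE.subset hfin
  obtain ⟨V, E, hVE, hcard⟩ := Nat.sSup_mem hPne hPbdd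
  refine ⟨V, E, hVE, fun g hg => ?_⟩
  by_contra! hfar
  obtain ⟨V', E', hVE', hlt⟩ := hVE.exists_card_lt hSsym hSgen hr hF hg hfar
  have := le_csSup hPbdd ⟨V', E', hVE', rfl⟩
  omega

end WordLength

theorem stmt12 {G : Type*} [Group G] (S : Set G) (hSfin : S.Finite)
    (hSsym : ∀ s ∈ S, s⁻¹ ∈ S) (hSgen : Subgroup.closure S = ⊤)
    -- super-linear growth
    (hgrowth : Tendsto (fun n : ℕ => (((wordBall S n).ncard : ℝ) / (n : ℝ))) atTop atTop) :
    ∃ c : ℝ, ∀ r : ℝ, 1 ≤ r → ∀ F : Set G,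
      IsFolner S 1 r F → RConnected S 1 F →
      -- F has a (2r)-skeleton (V, E) of d_G-weight at most c|F|/r
      ∃ (V : Finset G) (E : Finset (G × G)),
        ↑V ⊆ F ∧
        (∀ e ∈ E, e.1 ∈ V ∧ e.2 ∈ V) ∧
        (∀ g ∈ F, ∃ v ∈ V, (wordDist S g v : ℝ) ≤ 2 * r) ∧
        (∀ u ∈ V, ∀ v ∈ V, Relation.ReflTransGen (edgeStep E) u v) ∧
        (∑ e ∈ E, (wordDist S e.1 e.2 : ℝ)) ≤ c * (F.ncard : ℝ) / r := by
  refine ⟨12, fun r hr F hF hconn => ?_⟩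
  have hr0 : 0 ≤ r := by linarith
  obtain ⟨V, E, hVE, hdense⟩ := exists_isSeparatedGraph_dense hSsym hSgen hr0 hF.1 hF.2.1 hconn
  refine ⟨V, E, hVE.subset, hVE.mem, hdense, hVE.connected, ?_⟩
  have hsum : ∑ e ∈ E, (wordDist S e.1 e.2 : ℝ) ≤ V.card * (3 * r) := by
    calc ∑ e ∈ E, (wordDist S e.1 e.2 : ℝ) ≤ E.card * (2 * r + 1) := by
          simpa only [nsmul_eq_mul] using Finset.sum_le_card_nsmul E _ _ hVE.dist_le
      _ ≤ V.card * (3 * r) := by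
          gcongr
          · exact hVE.card_le
          · linarith
  have hcount : (V.card : ℝ) * (wordBall S r).ncard ≤ 2 * F.ncard :=
    card_mul_ncard_wordBall_le hSfin hSsym hSgen hr0 hF hVE.subset hVE.separated
  have hquad := sq_le_two_mul_ncard_wordBall hSfin hSsym hSgen hgrowth hr0
  have hV : (V.card : ℝ) * r ^ 2 ≤ 4 * F.ncard := by
    have := mul_le_mul_of_nonneg_left hquad (Nat.cast_nonneg (α := ℝ) V.card)
    linarith
  rw [le_div_iff₀ (by linarith)]
  have := mul_le_mul_of_nonneg_right hsum hr0
  linarith
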